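/- Assume n ≥ 3, and let u, v, w ∈ [n]. Then [t_u, t_{n−2}] · [t_v, t_{n−2}] · [t_w, t_{n−2}] = 0 in k[S_n]. -/

import Mathlib

/-- The simple transposition `s_i ∈ S_n` (1-based indexing), swapping `i` and `i+1`,
defined as the identity for `i` outside `{1, …, n-1}`. -/
def simpleTransposition (n i : ℕ) : Equiv.Perm (Fin n) :=
  if h : 1 ≤ i ∧ i < n then
    Equiv.swap ⟨i - 1, by omega⟩ ⟨i, h.2⟩
  else 1

/-- The cycle `(v ⟹ w) = s_v s_{v+1} ⋯ s_{w-1} ∈ S_n`, sending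
`v ↦ v+1 ↦ ⋯ ↦ w ↦ v` (and equal to the identity when `v = w`). -/
def cyc (n v w : ℕ) : Equiv.Perm (Fin n) :=
  ((List.range' v (w - v)).map (simpleTransposition n)).prod

/-- The somewhere-to-below shuffle `t_ℓ = Σ_{w=ℓ}^{n} (ℓ ⟹ w)` in the group
algebra `R[S_n]`. -/
noncomputable def t (R : Type*) [CommRing R] (n ℓ : ℕ) :
    MonoidAlgebra R (Equiv.Perm (Fin n)) :=
  ∑ w ∈ Finset.Icc ℓ n, MonoidAlgebra.of R (Equiv.Perm (Fin n)) (cyc n ℓ w)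

section ShuffleLemmas

variable {R : Type*} [CommRing R] {n : ℕ}

theorem swap_braid {α : Type*} [DecidableEq α] {a b c : α} (hab : a ≠ b) (hac : a ≠ c)
    (hbc : b ≠ c) :
    Equiv.swap a b * Equiv.swap b c * Equiv.swap a b =
      Equiv.swap b c * Equiv.swap a b * Equiv.swap b c := by
  rw [Equiv.swap_mul_swap_mul_swap hab hac, Equiv.swap_comm a b, Equiv.swap_comm b c,
    Equiv.swap_mul_swap_mul_swap hbc.symm hac.symm, Equiv.swap_comm]

theorem simpleTransposition_mul_self (i : ℕ) :
    simpleTransposition n i * simpleTransposition n i = 1 := by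
  unfold simpleTransposition
  split_ifs <;> simp

theorem simpleTransposition_commute {i j : ℕ} (h : i + 2 ≤ j) :
    Commute (simpleTransposition n i) (simpleTransposition n j) := by
  unfold simpleTransposition
  split_ifs with hi hj
  · apply Equiv.Perm.Disjoint.commute
    intro x
    by_cases hx : x.val < j - 1
    · right
      apply Equiv.swap_apply_of_ne_of_ne <;> simp only [ne_eq, Fin.ext_iff] <;> omega
    · left
      apply Equiv.swap_apply_of_ne_of_ne <;> simp only [ne_eq, Fin.ext_iff] <;> omega
  · exact Commute.one_right _
  · exact Commute.one_left _
  · exact Commute.one_left _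

theorem simpleTransposition_braid {i : ℕ} (hi : 1 ≤ i) (hn : i + 1 < n) :
    simpleTransposition n i * simpleTransposition n (i + 1) * simpleTransposition n i =
      simpleTransposition n (i + 1) * simpleTransposition n i *
        simpleTransposition n (i + 1) := by
  have h₁ : 1 ≤ i ∧ i < n := ⟨hi, by omega⟩
  have h₂ : 1 ≤ i + 1 ∧ i + 1 < n := ⟨by omega, hn⟩
  simp only [simpleTransposition, dif_pos h₁, dif_pos h₂, Nat.add_sub_cancel]
  have hab : (⟨i - 1, by omega⟩ : Fin n) ≠ ⟨i, by omega⟩ := by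
    simp only [ne_eq, Fin.ext_iff]; omega
  have hac : (⟨i - 1, by omega⟩ : Fin n) ≠ ⟨i + 1, hn⟩ := by
    simp only [ne_eq, Fin.ext_iff]; omega
  have hbc : (⟨i, by omega⟩ : Fin n) ≠ ⟨i + 1, hn⟩ := by
    simp only [ne_eq, Fin.ext_iff]; omega
  exact swap_braid hab hac hbc

theorem cyc_self (v : ℕ) : cyc n v v = 1 := by
  simp [cyc]

theorem cyc_mul_cyc {u v w : ℕ} (huv : u ≤ v) (hvw : v ≤ w) :
    cyc n u v * cyc n v w = cyc n u w := by
  unfold cyc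
  rw [← List.prod_append, ← List.map_append,
    show w - u = (v - u) + (w - v) by omega, ← List.range'_append_1,
    Nat.add_sub_cancel' huv]

theorem cyc_succ_self (v : ℕ) : cyc n v (v + 1) = simpleTransposition n v := by
  simp [cyc]

theorem cyc_commute_simpleTransposition {v w i : ℕ} (h : w < i) :
    Commute (cyc n v w) (simpleTransposition n i) := by
  apply Commute.list_prod_left
  intro x hx
  obtain ⟨l, hl, rfl⟩ := List.mem_map.mp hx
  rw [List.mem_range'_1] at hl
  exact simpleTransposition_commute (by omega)

theorem t_self (n : ℕ) : t R n n = 1 := by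
  simp [t, cyc_self, MonoidAlgebra.one_def]

theorem t_eq_sum_add_cyc_mul_t {u j : ℕ} (huj : u ≤ j) (hjn : j ≤ n) :
    t R n u = ∑ w ∈ Finset.Ico u j, MonoidAlgebra.of R (Equiv.Perm (Fin n)) (cyc n u w) +
      MonoidAlgebra.of R (Equiv.Perm (Fin n)) (cyc n u j) * t R n j := by
  unfold t
  rw [← Finset.Ico_add_one_right_eq_Icc, ← Finset.Ico_add_one_right_eq_Icc,
    ← Finset.sum_Ico_consecutive _ huj (by omega : j ≤ n + 1), Finset.mul_sum]
  congr 1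
  refine Finset.sum_congr rfl fun w hw => ?_
  rw [← map_mul, cyc_mul_cyc huj (Finset.mem_Ico.mp hw).1]

theorem t_eq_one_add {l : ℕ} (hl : l < n) :
    t R n l = 1 + MonoidAlgebra.of R (Equiv.Perm (Fin n)) (simpleTransposition n l) *
      t R n (l + 1) := by
  rw [t_eq_sum_add_cyc_mul_t (Nat.le_succ l) hl]
  simp [cyc_self, cyc_succ_self, MonoidAlgebra.one_def]

theorem of_cyc_commute_t {v w l : ℕ} (h : w < l) (hl : l ≤ n) :
    Commute (MonoidAlgebra.of R (Equiv.Perm (Fin n)) (cyc n v w)) (t R n l) := by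
  induction hl using Nat.decreasingInduction with
  | self => rw [t_self]; exact Commute.one_right _
  | of_succ l hl ih =>
    rw [t_eq_one_add hl]
    exact (Commute.one_right _).add_right
      (((cyc_commute_simpleTransposition h).map _).mul_right (ih (by omega)))

theorem t_commutator_eq {u j : ℕ} (huj : u ≤ j) (hjn : j ≤ n) :
    t R n u * t R n j - t R n j * t R n u =
      (MonoidAlgebra.of R (Equiv.Perm (Fin n)) (cyc n u j) * t R n j -
        t R n j * MonoidAlgebra.of R (Equiv.Perm (Fin n)) (cyc n u j)) * t R n j := by
  have h : Commute
      (∑ w ∈ Finset.Ico u j, MonoidAlgebra.of R (Equiv.Perm (Fin n)) (cyc n u w))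
      (t R n j) :=
    Commute.sum_left _ _ _ fun w hw => of_cyc_commute_t (Finset.mem_Ico.mp hw).2 hjn
  rw [t_eq_sum_add_cyc_mul_t huj hjn, add_mul, mul_add, h.eq]
  noncomm_ring

end ShuffleLemmas

section RingLemmas

variable {A : Type*} [Ring A] {s r : A}

theorem mul_symmetrizer (hs : s * s = 1) (hb : s * r * s = r * s * r) :
    s * ((1 + r) * (1 + s * (1 + r))) = (1 + r) * (1 + s * (1 + r)) := by
  have h₁ : s * (s * r) = r := by rw [← mul_assoc, hs, one_mul]
  have h₂ : s * (r * s) = r * (s * r) := by simpa only [mul_assoc] using hb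
  have h₃ : s * (r * (s * r)) = r * s := by rw [← h₂, ← mul_assoc, hs, one_mul]
  simp only [mul_add, add_mul, mul_one, one_mul, hs, h₁, h₂, h₃]
  abel

theorem symmetrizer_mul_left (hs : s * s = 1) (hr : r * r = 1) (hb : s * r * s = r * s * r) :
    (1 + r) * (1 + s * (1 + r)) * s = (1 + r) * (1 + s * (1 + r)) := by
  have h₁ : s * (r * s) = r * (s * r) := by simpa only [mul_assoc] using hb
  have h₂ : r * (r * (s * r)) = s * r := by rw [← mul_assoc, hr, one_mul]
  simp only [mul_add, add_mul, mul_one, one_mul, mul_assoc, hs, h₁, h₂]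
  abel

theorem symmetrizer_mul_right (hr : r * r = 1) :
    (1 + r) * (1 + s * (1 + r)) * r = (1 + r) * (1 + s * (1 + r)) := by
  simp only [mul_add, add_mul, mul_one, one_mul, mul_assoc, hr]
  abel

theorem symmetrizer_commutator {q : A} (hq : Commute q r) (hs : s * s = 1)
    (hb : s * r * s = r * s * r) :
    (q * (1 + s * (1 + r)) - (1 + s * (1 + r)) * q) * (1 + s * (1 + r)) =
      (1 - s) * q * ((1 + r) * (1 + s * (1 + r))) := by
  have h : q * (1 + s * (1 + r)) - (1 + s * (1 + r)) * q =
      q * s * (1 + r) - s * q * (1 + r) := by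
    simp only [mul_add, add_mul, mul_one, one_mul, mul_assoc, hq.eq]
    abel
  rw [h, sub_mul, mul_assoc, mul_assoc q s, mul_symmetrizer hs hb, mul_assoc (s * q), ← sub_mul,
    sub_mul 1 s q, one_mul]

end RingLemmas

section ShuffleCommutators

variable {R : Type*} [CommRing R]

theorem t_succ_eq {j : ℕ} :
    t R (j + 2) (j + 1) =
      1 + MonoidAlgebra.of R _ (simpleTransposition (j + 2) (j + 1)) := by
  rw [t_eq_one_add (Nat.lt_succ_self (j + 1)), t_self, mul_one]

theorem t_eq {j : ℕ} :
    t R (j + 2) j = 1 + MonoidAlgebra.of R _ (simpleTransposition (j + 2) j) *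
      (1 + MonoidAlgebra.of R _ (simpleTransposition (j + 2) (j + 1))) := by
  rw [t_eq_one_add (by omega), t_succ_eq]

theorem of_simpleTransposition_mul_self (n i : ℕ) :
    MonoidAlgebra.of R _ (simpleTransposition n i) *
      MonoidAlgebra.of R _ (simpleTransposition n i) = 1 := by
  rw [← map_mul, simpleTransposition_mul_self, map_one]

theorem of_simpleTransposition_braid {j : ℕ} (hj : 1 ≤ j) :
    MonoidAlgebra.of R _ (simpleTransposition (j + 2) j) *
        MonoidAlgebra.of R _ (simpleTransposition (j + 2) (j + 1)) *
        MonoidAlgebra.of R _ (simpleTransposition (j + 2) j) =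
      MonoidAlgebra.of R _ (simpleTransposition (j + 2) (j + 1)) *
        MonoidAlgebra.of R _ (simpleTransposition (j + 2) j) *
        MonoidAlgebra.of R _ (simpleTransposition (j + 2) (j + 1)) := by
  simp only [← map_mul, simpleTransposition_braid hj (Nat.lt_succ_self (j + 1))]

/-- For `u ≤ j`, the commutator `[t_u, t_j]` in `R[S_{j+2}]` factors through
`N = t_{j+1} t_j` on the right and `1 - s_j` in the middle. -/
theorem t_commutator_factorization {u j : ℕ} (hj : 1 ≤ j) (huj : u ≤ j) :
    ∃ z y : MonoidAlgebra R (Equiv.Perm (Fin (j + 2))),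
      Commute z (t R (j + 2) (j + 1) * t R (j + 2) j) ∧
      t R (j + 2) u * t R (j + 2) j - t R (j + 2) j * t R (j + 2) u =
        z * ((1 - MonoidAlgebra.of R _ (simpleTransposition (j + 2) j)) * y *
          (t R (j + 2) (j + 1) * t R (j + 2) j)) := by
  rcases huj.eq_or_lt with rfl | hlt
  · exact ⟨0, 0, Commute.zero_left _, by simp⟩
  obtain ⟨i, rfl⟩ : ∃ i, j = i + 1 := ⟨j - 1, by omega⟩
  have hz : Commute (MonoidAlgebra.of R _ (cyc (i + 1 + 2) u i)) (t R (i + 1 + 2) (i + 1)) :=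
    of_cyc_commute_t (by omega) (by omega)
  refine ⟨MonoidAlgebra.of R _ (cyc (i + 1 + 2) u i),
    MonoidAlgebra.of R _ (simpleTransposition (i + 1 + 2) i),
    (of_cyc_commute_t (by omega) (by omega)).mul_right hz, ?_⟩
  rw [t_commutator_eq huj (by omega), ← cyc_mul_cyc (by omega : u ≤ i) (Nat.le_succ i),
    cyc_succ_self, map_mul, ← mul_assoc (t R (i + 1 + 2) (i + 1)), ← hz.eq, mul_assoc, mul_assoc,
    ← mul_sub, mul_assoc, t_succ_eq, t_eq,
    symmetrizer_commutator ((simpleTransposition_commute le_rfl).map _)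
      (of_simpleTransposition_mul_self _ _) (of_simpleTransposition_braid hj)]

theorem t_succ_commutator_eq {j : ℕ} :
    t R (j + 2) (j + 1) * t R (j + 2) j - t R (j + 2) j * t R (j + 2) (j + 1) =
      (MonoidAlgebra.of R _ (simpleTransposition (j + 2) (j + 1)) - 1) *
        (MonoidAlgebra.of R _ (simpleTransposition (j + 2) j) * t R (j + 2) (j + 1)) := by
  have hr := of_simpleTransposition_mul_self (R := R) (j + 2) (j + 1)
  rw [t_succ_eq, t_eq]
  simp only [mul_add, add_mul, sub_mul, mul_one, one_mul, mul_assoc, hr]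
  abel

theorem symmetrizer_mul_t_commutator {u j : ℕ} (hj : 1 ≤ j) (hun : u ≤ j + 2) :
    t R (j + 2) (j + 1) * t R (j + 2) j *
      (t R (j + 2) u * t R (j + 2) j - t R (j + 2) j * t R (j + 2) u) = 0 := by
  have hb := of_simpleTransposition_braid (R := R) hj
  rcases (by omega : u ≤ j ∨ u = j + 1 ∨ u = j + 2) with h | rfl | rfl
  · obtain ⟨z, y, hz, h⟩ := t_commutator_factorization (R := R) hj h
    have hN : t R (j + 2) (j + 1) * t R (j + 2) j *
        (1 - MonoidAlgebra.of R _ (simpleTransposition (j + 2) j)) = 0 := by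
      rw [t_succ_eq, t_eq, mul_sub, mul_one,
        symmetrizer_mul_left (of_simpleTransposition_mul_self _ _)
          (of_simpleTransposition_mul_self _ _) hb, sub_self]
    rw [h, ← mul_assoc, ← hz.eq, mul_assoc, ← mul_assoc _ _ (t R _ _ * _), ← mul_assoc _ _ y, hN]
    simp
  · rw [t_succ_commutator_eq, ← mul_assoc, mul_sub, mul_one, t_eq, t_succ_eq,
      symmetrizer_mul_right (of_simpleTransposition_mul_self _ _), sub_self, zero_mul]
  · simp [t_self]

theorem t_succ_commutator_sq {j : ℕ} :
    (t R (j + 2) (j + 1) * t R (j + 2) j - t R (j + 2) j * t R (j + 2) (j + 1)) *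
      (t R (j + 2) (j + 1) * t R (j + 2) j - t R (j + 2) j * t R (j + 2) (j + 1)) = 0 := by
  have h : t R (j + 2) (j + 1) *
      (MonoidAlgebra.of R _ (simpleTransposition (j + 2) (j + 1)) - 1) = 0 := by
    rw [t_succ_eq, add_mul, one_mul, mul_sub, of_simpleTransposition_mul_self, mul_one]
    abel
  rw [t_succ_commutator_eq, mul_assoc, mul_assoc _ (t R _ _), ← mul_assoc (t R _ _), h]
  simp

/-- Two commutators with `t_j` in `R[S_{j+2}]` multiply to zero unless the left one is
`[t_{j+1}, t_j]` and the right one is not. -/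
theorem t_commutator_mul_t_commutator {u v j : ℕ} (hj : 1 ≤ j) (hun : u ≤ j + 2)
    (hvn : v ≤ j + 2) (h : u = j + 1 → v = j + 1) :
    (t R (j + 2) u * t R (j + 2) j - t R (j + 2) j * t R (j + 2) u) *
      (t R (j + 2) v * t R (j + 2) j - t R (j + 2) j * t R (j + 2) v) = 0 := by
  rcases (by omega : u ≤ j ∨ u = j + 1 ∨ u = j + 2) with h' | rfl | rfl
  · obtain ⟨z, y, -, h⟩ := t_commutator_factorization (R := R) hj h'
    rw [h, mul_assoc, mul_assoc, symmetrizer_mul_t_commutator hj hvn, mul_zero, mul_zero]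
  · rw [h rfl, t_succ_commutator_sq]
  · simp [t_self]

end ShuffleCommutators

theorem comm_t_nm2_cube_vanishing
    (R : Type*) [CommRing R] (n : ℕ) (hn : 3 ≤ n)
    (u v w : ℕ) (hu1 : 1 ≤ u) (hun : u ≤ n) (hv1 : 1 ≤ v) (hvn : v ≤ n)
    (hw1 : 1 ≤ w) (hwn : w ≤ n) :
    (t R n u * t R n (n - 2) - t R n (n - 2) * t R n u) *
      (t R n v * t R n (n - 2) - t R n (n - 2) * t R n v) *
      (t R n w * t R n (n - 2) - t R n (n - 2) * t R n w) = 0 := by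
  obtain ⟨j, rfl⟩ : ∃ j, n = j + 2 := ⟨n - 2, by omega⟩
  rw [Nat.add_sub_cancel]
  have hj : 1 ≤ j := by omega
  by_cases h : u = j + 1 → v = j + 1
  · rw [t_commutator_mul_t_commutator hj hun hvn h, zero_mul]
  · rw [mul_assoc, t_commutator_mul_t_commutator hj hvn hwn (by omega), mul_zero]
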